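/- Let s = (x,y) ∈ ℝ² with s ≠ 0, let π ∈ ℝ², let χ̂ > 0, v_max > 0, w_max > 0, and suppose λ₁ ∈ [0,1], λ₂ ∈ [−w_max, w_max], and v_r ∈ ℝ² with ‖v_r‖ = 1 satisfy λ₁(−π) + λ₂ s_⊥/‖s_⊥‖ = χ̂ v_max v_r. Then the camera inputs v = v_max (v_r, 0) ∈ ℝ³ and w = λ₂ (s/‖s‖, 0) ∈ ℝ³ satisfy all constraints of the constant-depth active estimation problem: (a) the tracking equation J_v(s) v χ̂ + J_w(s) w = λ₁ π; (b) J_q v = 0; (c) J_l(s) w = 0; (d) ‖v‖ = v_max; and (e) ‖w‖ = |λ₂| ≤ w_max. -/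

import Mathlib

/-- The point `s = (x,y)` as a vector of `ℝ²` with the Euclidean norm. -/
noncomputable def e2 (a b : ℝ) : EuclideanSpace ℝ (Fin 2) :=
  (WithLp.equiv 2 (Fin 2 → ℝ)).symm ![a, b]

/-- A vector of `ℝ³` with the Euclidean norm. -/
noncomputable def e3 (a b c : ℝ) : EuclideanSpace ℝ (Fin 3) :=
  (WithLp.equiv 2 (Fin 3 → ℝ)).symm ![a, b, c]

/-- `J_v(s) v` for `s = (x,y)`: the matrix `[[−1,0,x],[0,−1,y]]` applied to `v`. -/
noncomputable def JvE (x y : ℝ) (v : EuclideanSpace ℝ (Fin 3)) :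
    EuclideanSpace ℝ (Fin 2) :=
  e2 (x * v 2 - v 0) (y * v 2 - v 1)

/-- `J_w(s) w` for `s = (x,y)`: `[[xy, −(1+x²), y],[1+y², −xy, −x]]` applied to `w`. -/
noncomputable def JwE (x y : ℝ) (w : EuclideanSpace ℝ (Fin 3)) :
    EuclideanSpace ℝ (Fin 2) :=
  e2 (x * y * w 0 - (1 + x ^ 2) * w 1 + y * w 2)
    ((1 + y ^ 2) * w 0 - x * y * w 1 - x * w 2)

/-- `J_q v` for `J_q = [0,0,1]`. -/
noncomputable def JqE (v : EuclideanSpace ℝ (Fin 3)) : ℝ := v 2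

/-- `J_l(s) w` for `s = (x,y)` and `J_l(s) = [y,−x,0]`. -/
noncomputable def JlE (x y : ℝ) (w : EuclideanSpace ℝ (Fin 3)) : ℝ :=
  y * w 0 - x * w 1

theorem e2_apply_zero (a b : ℝ) : e2 a b 0 = a := rfl

theorem e2_apply_one (a b : ℝ) : e2 a b 1 = b := rfl

theorem e3_apply_zero (a b c : ℝ) : e3 a b c 0 = a := rfl

theorem e3_apply_one (a b c : ℝ) : e3 a b c 1 = b := rfl

theorem e3_apply_two (a b c : ℝ) : e3 a b c 2 = c := rfl

theorem norm_e2_sq (a b : ℝ) : ‖e2 a b‖ ^ 2 = a ^ 2 + b ^ 2 := by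
  simp [EuclideanSpace.norm_sq_eq, Fin.sum_univ_two, e2_apply_zero, e2_apply_one]

theorem norm_e3_sq (a b c : ℝ) : ‖e3 a b c‖ ^ 2 = a ^ 2 + b ^ 2 + c ^ 2 := by
  simp [EuclideanSpace.norm_sq_eq, Fin.sum_univ_three, e3_apply_zero, e3_apply_one, e3_apply_two]

/-- Rotating a planar vector by a right angle preserves its norm. -/
theorem norm_e2_perp (a b : ℝ) : ‖e2 (-b) a‖ = ‖e2 a b‖ := by
  rw [← sq_eq_sq₀ (norm_nonneg _) (norm_nonneg _), norm_e2_sq, norm_e2_sq]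
  ring

theorem norm_e2_ne_zero {a b : ℝ} (h : ¬(a = 0 ∧ b = 0)) : ‖e2 a b‖ ≠ 0 := by
  intro h0
  have hsq := norm_e2_sq a b
  rw [h0] at hsq
  exact h ⟨by nlinarith [sq_nonneg a, sq_nonneg b], by nlinarith [sq_nonneg a, sq_nonneg b]⟩

/-- If `λ₁ ∈ [0,1]`, `λ₂ ∈ [−w_max, w_max]` and a unit vector `v_r` satisfy
`λ₁(−π) + λ₂ s_⊥/‖s_⊥‖ = χ̂ v_max v_r`, then the camera inputs `v = v_max (v_r, 0)`
and `w = λ₂ (s/‖s‖, 0)` satisfy all constraints of the constant-depth active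
estimation problem: (a) `J_v(s) v χ̂ + J_w(s) w = λ₁ π`; (b) `J_q v = 0`;
(c) `J_l(s) w = 0`; (d) `‖v‖ = v_max`; (e) `‖w‖ = |λ₂| ≤ w_max`. -/
theorem constant_depth_solution_feasible
    (x y : ℝ) (p : EuclideanSpace ℝ (Fin 2)) (chihat vmax wmax l₁ l₂ : ℝ)
    (vr : EuclideanSpace ℝ (Fin 2))
    (hs : ¬(x = 0 ∧ y = 0)) (hchihat : 0 < chihat) (hvmax : 0 < vmax)
    (hwmax : 0 < wmax) (hl₁0 : 0 ≤ l₁) (hl₁1 : l₁ ≤ 1)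
    (hl₂l : -wmax ≤ l₂) (hl₂u : l₂ ≤ wmax) (hvr : ‖vr‖ = 1)
    (heq : l₁ • (-p) + (l₂ / ‖e2 (-y) x‖) • e2 (-y) x = (chihat * vmax) • vr) :
    ∀ v w : EuclideanSpace ℝ (Fin 3),
      v = e3 (vmax * vr 0) (vmax * vr 1) 0 →
      w = e3 (l₂ * x / ‖e2 x y‖) (l₂ * y / ‖e2 x y‖) 0 →
      chihat • JvE x y v + JwE x y w = l₁ • p ∧
      JqE v = 0 ∧
      JlE x y w = 0 ∧
      ‖v‖ = vmax ∧
      (‖w‖ = |l₂| ∧ ‖w‖ ≤ wmax) := by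
  rintro v w rfl rfl
  have hn := norm_e2_ne_zero hs
  have hsq := norm_e2_sq x y
  rw [norm_e2_perp] at heq
  have hw : ‖e3 (l₂ * x / ‖e2 x y‖) (l₂ * y / ‖e2 x y‖) 0‖ = |l₂| := by
    rw [← sq_eq_sq₀ (norm_nonneg _) (abs_nonneg _), norm_e3_sq, sq_abs]
    field_simp
    rw [hsq]
    ring
  have hv : ‖e3 (vmax * vr 0) (vmax * vr 1) 0‖ = vmax := by
    have hr : vr 0 ^ 2 + vr 1 ^ 2 = 1 := by
      have h := EuclideanSpace.norm_sq_eq vr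
      simpa [hvr, Fin.sum_univ_two, eq_comm] using h
    rw [← sq_eq_sq₀ (norm_nonneg _) hvmax.le, norm_e3_sq]
    linear_combination vmax ^ 2 * hr
  refine ⟨?_, rfl, ?_, hv, hw, hw.trans_le (abs_le.2 ⟨hl₂l, hl₂u⟩)⟩
  · have h0 := congrArg (fun u : EuclideanSpace ℝ (Fin 2) => u 0) heq
    have h1 := congrArg (fun u : EuclideanSpace ℝ (Fin 2) => u 1) heq
    simp only [PiLp.add_apply, PiLp.smul_apply, PiLp.neg_apply, smul_eq_mul,
      e2_apply_zero, e2_apply_one] at h0 h1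
    ext i
    fin_cases i
    · simp only [Fin.zero_eta, JvE, JwE, PiLp.add_apply, PiLp.smul_apply, smul_eq_mul,
        e2_apply_zero, e3_apply_zero, e3_apply_one, e3_apply_two]
      linear_combination h0
    · simp only [Fin.mk_one, JvE, JwE, PiLp.add_apply, PiLp.smul_apply, smul_eq_mul,
        e2_apply_one, e3_apply_zero, e3_apply_one, e3_apply_two]
      linear_combination h1
  · simp only [JlE, e3_apply_zero, e3_apply_one]
    ring
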